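/- Let V be a normed real vector space with dual V' (bounded functionals with operator norm), and let α lie in a quotient seminormed space arising from a normed chain complex as in ℓ¹-homology duality: for a class α ∈ H^M_i(X,B;ℝ), its ℓ¹-seminorm satisfies ‖α‖₁ = max { ⟨φ, α⟩ : φ ∈ H^i_M(X,B;ℝ), ‖φ‖_∞ ≤ 1 }. -/

import Mathlib

open scoped BigOperators
open Topology
noncomputable section

/-! ### Quasicones and marked spaces -/

/-- `B` is a *quasicone* with apex `b`: there is a homotopy `H` from the identity to the
constant map at `b` with `H ⁻¹' {b} = ({b} × I) ∪ (B × {1})`. -/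
def IsQuasicone {B : Type*} [TopologicalSpace B] (b : B) : Prop :=
  ∃ H : C(B × unitInterval, B),
    (∀ x, H (x, 0) = x) ∧ (∀ x, H (x, 1) = b) ∧
    (∀ x t, H (x, t) = b ↔ x = b ∨ t = 1)

/-- A *marked space* `(X, B)`: `B` is closed in `X` and every `b ∈ B` has a closed
quasiconical neighbourhood `F b` with apex `b`, the `F b` being pairwise disjoint. -/
structure IsMarkedSpace (X : Type*) [TopologicalSpace X] (B : Set X) : Prop where
  closed : IsClosed B
  quasicones : ∃ F : B → Set X,
    (∀ b : B, IsClosed (F b)) ∧ (∀ b : B, F b ∈ nhds (b : X)) ∧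
    (∀ b b' : B, b ≠ b' → Disjoint (F b) (F b')) ∧
    (∀ b : B, ∃ hb : (b : X) ∈ F b, IsQuasicone (⟨(b : X), hb⟩ : F b))

/-! ### Singular chains -/

/-- The topological standard `n`-simplex. -/
abbrev TopSimplex (n : ℕ) : Type := ↥(stdSimplex ℝ (Fin (n + 1)))

/-- Singular `n`-simplices in `X`. -/
abbrev SingularSimplex (X : Type*) [TopologicalSpace X] (n : ℕ) := C(TopSimplex n, X)

/-- Singular `n`-chains in `X` with coefficients in `R`. -/
abbrev SingularChain (R : Type*) [Ring R] (X : Type*) [TopologicalSpace X] (n : ℕ) :=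
  SingularSimplex X n →₀ R

/-- The `i`-th coface map, on barycentric coordinates. -/
def cofaceFun {n : ℕ} (i : Fin (n + 2)) (x : Fin (n + 1) → ℝ) : Fin (n + 2) → ℝ :=
  fun j => ∑ k : Fin (n + 1), if i.succAbove k = j then x k else 0

lemma cofaceFun_mem {n : ℕ} (i : Fin (n + 2)) {x : Fin (n + 1) → ℝ}
    (hx : x ∈ stdSimplex ℝ (Fin (n + 1))) : cofaceFun i x ∈ stdSimplex ℝ (Fin (n + 2)) := by
  constructor
  · intro j
    refine Finset.sum_nonneg fun k _ => ?_
    split_ifs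
    · exact hx.1 k
    · exact le_rfl
  · unfold cofaceFun
    rw [Finset.sum_comm]
    simp only [Finset.sum_ite_eq, Finset.mem_univ, if_true]
    exact hx.2

/-- The `i`-th face inclusion `Δⁿ → Δⁿ⁺¹`. -/
def coface {n : ℕ} (i : Fin (n + 2)) : C(TopSimplex n, TopSimplex (n + 1)) where
  toFun x := ⟨cofaceFun i (x : Fin (n + 1) → ℝ), cofaceFun_mem i x.2⟩
  continuous_toFun := by
    refine Continuous.subtype_mk ?_ _
    refine continuous_pi fun j => ?_
    unfold cofaceFun
    refine continuous_finset_sum _ fun k _ => ?_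
    by_cases h : i.succAbove k = j
    · simp only [if_pos h]
      exact (continuous_apply k).comp continuous_subtype_val
    · simp only [if_neg h]
      exact continuous_const

/-- The boundary of a single `(n+1)`-simplex. -/
def boundaryOf (R : Type*) [Ring R] {X : Type*} [TopologicalSpace X] {n : ℕ}
    (σ : SingularSimplex X (n + 1)) : SingularChain R X n :=
  ∑ i : Fin (n + 2), Finsupp.single (σ.comp (coface i)) ((-1 : R) ^ (i : ℕ))

/-- The singular boundary operator. -/
def boundary (R : Type*) [Ring R] (X : Type*) [TopologicalSpace X] (n : ℕ) :
    SingularChain R X (n + 1) →ₗ[R] SingularChain R X n :=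
  Finsupp.lsum ℕ fun σ => LinearMap.toSpanSingleton R _ (boundaryOf R σ)

/-- Push-forward of chains along a continuous map. -/
def pushChain (R : Type*) [Ring R] {X Y : Type*} [TopologicalSpace X] [TopologicalSpace Y]
    (f : C(X, Y)) (n : ℕ) : SingularChain R X n →ₗ[R] SingularChain R Y n :=
  Finsupp.lmapDomain R R fun σ : SingularSimplex X n => f.comp σ

/-- The face of `Δⁿ` spanned by the vertices in `S`. -/
def faceSet (n : ℕ) (S : Finset (Fin (n + 1))) : Set (TopSimplex n) :=
  {x | ∀ j ∉ S, (x : Fin (n + 1) → ℝ) j = 0}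

/-- A subset of `Δⁿ` which is a union of (not necessarily proper) faces. -/
def IsSimplicialSubcomplex {n : ℕ} (A : Set (TopSimplex n)) : Prop :=
  ∃ 𝒮 : Set (Finset (Fin (n + 1))), A = ⋃ S ∈ 𝒮, faceSet n S

/-- A singular simplex is *admissible* if the preimage of `B` is a union of faces. -/
def Admissible {X : Type*} [TopologicalSpace X] (B : Set X) {n : ℕ}
    (σ : SingularSimplex X n) : Prop :=
  IsSimplicialSubcomplex (σ ⁻¹' B)

/-- The submodule generated by admissible simplices. -/
def admissibleChains (R : Type*) [Ring R] (X : Type*) [TopologicalSpace X] (B : Set X)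
    (n : ℕ) : Submodule R (SingularChain R X n) :=
  Submodule.span R {c | ∃ σ : SingularSimplex X n, Admissible B σ ∧ c = Finsupp.single σ 1}

/-- The submodule generated by simplices supported in `B`. -/
def chainsIn (R : Type*) [Ring R] (X : Type*) [TopologicalSpace X] (B : Set X)
    (n : ℕ) : Submodule R (SingularChain R X n) :=
  Submodule.span R {c | ∃ σ : SingularSimplex X n, Set.range ⇑σ ⊆ B ∧ c = Finsupp.single σ 1}

/-- Cycles of the marked chain complex `C^M_*(X,B;R) = Ĉ^M_*(X,B;R)/C_*(B;R)`:
admissible chains whose boundary is supported in `B`. -/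
def markedCycles (R : Type*) [Ring R] (X : Type*) [TopologicalSpace X] (B : Set X) :
    (n : ℕ) → Submodule R (SingularChain R X n)
  | 0 => admissibleChains R X B 0
  | (n + 1) => admissibleChains R X B (n + 1) ⊓
      Submodule.comap (boundary R X n) (chainsIn R X B n)

/-- Boundaries of the marked chain complex. -/
def markedBoundaries (R : Type*) [Ring R] (X : Type*) [TopologicalSpace X] (B : Set X)
    (n : ℕ) : Submodule R (SingularChain R X n) :=
  Submodule.map (boundary R X n) (admissibleChains R X B (n + 1)) ⊔ chainsIn R X B n

/-- Relative cycles of the pair `(X, B)`. -/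
def relativeCycles (R : Type*) [Ring R] (X : Type*) [TopologicalSpace X] (B : Set X) :
    (n : ℕ) → Submodule R (SingularChain R X n)
  | 0 => ⊤
  | (n + 1) => Submodule.comap (boundary R X n) (chainsIn R X B n)

/-- Relative boundaries of the pair `(X, B)`. -/
def relativeBoundaries (R : Type*) [Ring R] (X : Type*) [TopologicalSpace X] (B : Set X)
    (n : ℕ) : Submodule R (SingularChain R X n) :=
  Submodule.map (boundary R X n) ⊤ ⊔ chainsIn R X B n

/-- The ℓ¹-norm of a real singular chain. -/
def l1Norm {X : Type*} [TopologicalSpace X] {n : ℕ} (c : SingularChain ℝ X n) : ℝ :=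
  c.sum fun _ r => |r|

/-- The ℓ¹-seminorm of the marked homology class of the marked cycle `c`: the infimum of
the ℓ¹-norms of the marked cycles in its class. -/
noncomputable def markedClassSeminorm {X : Type*} [TopologicalSpace X] (B : Set X)
    {i : ℕ} (c : SingularChain ℝ X i) : ℝ :=
  sInf { r | ∃ z ∈ markedCycles ℝ X B i, z - c ∈ markedBoundaries ℝ X B i ∧ r = l1Norm z }

/-- A *marked bounded cocycle* of norm at most one: a linear functional on `i`-chains
which vanishes on chains supported in `B`, vanishes on boundaries of admissible chains
(so it is a cocycle of the dual marked complex), and takes values of absolute value at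
most `1` on admissible simplices (so `‖f‖_∞ ≤ 1`). -/
def IsNormOneMarkedCocycle {X : Type*} [TopologicalSpace X] (B : Set X) (i : ℕ)
    (f : SingularChain ℝ X i →ₗ[ℝ] ℝ) : Prop :=
  (∀ σ : SingularSimplex X i, Admissible B σ → |f (Finsupp.single σ 1)| ≤ 1) ∧
  (∀ z ∈ chainsIn ℝ X B i, f z = 0) ∧
  (∀ d ∈ admissibleChains ℝ X B (i + 1), f (boundary ℝ X i d) = 0)

/-! ### Hahn–Banach duality for quotient seminorms -/

/-- The quotient seminorm of a class modulo `W` is the value of a functional which is bounded by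
the norm and vanishes on `W`. -/
lemma exists_dual_eq_quotient_norm {E : Type*} [SeminormedAddCommGroup E] [NormedSpace ℝ E]
    (W : Submodule ℝ E) (c : E) :
    ∃ g : E →ₗ[ℝ] ℝ, (∀ x, |g x| ≤ ‖x‖) ∧ (∀ w ∈ W, g w = 0) ∧
      g c = sInf {r | ∃ z, z - c ∈ W ∧ r = ‖z‖} := by
  obtain ⟨g, hg, hgc⟩ := exists_dual_vector'' ℝ (W.mkQ c)
  refine ⟨g.toLinearMap ∘ₗ W.mkQ, fun x => ?_, fun w hw => ?_, ?_⟩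
  · calc |g (W.mkQ x)| ≤ ‖g‖ * ‖W.mkQ x‖ := g.le_opNorm _
      _ ≤ 1 * ‖x‖ := mul_le_mul hg (Submodule.Quotient.norm_mk_le W x) (norm_nonneg _) zero_le_one
      _ = ‖x‖ := one_mul _
  · have h0 : W.mkQ w = 0 := by simpa using hw
    change g (W.mkQ w) = 0
    rw [h0, map_zero]
  · change g (W.mkQ c) = _
    rw [hgc]
    refine (quotient_norm_mk_eq W.toAddSubgroup c).trans ?_
    congr 1
    ext r
    constructor
    · rintro ⟨w, hw, rfl⟩
      exact ⟨c + w, by simpa using hw, rfl⟩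
    · rintro ⟨z, hz, rfl⟩
      exact ⟨z - c, hz, by simp⟩

/-- Version of `exists_dual_eq_quotient_norm` for an unbundled seminorm. -/
lemma Seminorm.exists_dual_eq_quotient {E : Type*} [AddCommGroup E] [Module ℝ E]
    (p : Seminorm ℝ E) (W : Submodule ℝ E) (c : E) :
    ∃ g : E →ₗ[ℝ] ℝ, (∀ x, |g x| ≤ p x) ∧ (∀ w ∈ W, g w = 0) ∧
      g c = sInf {r | ∃ z, z - c ∈ W ∧ r = p z} := by
  let : SeminormedAddCommGroup E := p.toAddGroupSeminorm.toSeminormedAddCommGroup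
  let : NormedSpace ℝ E := ⟨fun a x => (map_smul_eq_mul p a x).le⟩
  exact exists_dual_eq_quotient_norm W c

/-! ### The ℓ¹-norm -/

section

variable {X : Type*} [TopologicalSpace X] {n : ℕ}

lemma l1Norm_eq_sum {c : SingularChain ℝ X n} {s : Finset (SingularSimplex X n)}
    (hs : c.support ⊆ s) : l1Norm c = ∑ σ ∈ s, |c σ| :=
  Finsupp.sum_of_support_subset _ hs _ fun _ _ => abs_zero

lemma l1Norm_single (σ : SingularSimplex X n) (r : ℝ) : l1Norm (Finsupp.single σ r) = |r| :=
  Finsupp.sum_single_index abs_zero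

/-- The ℓ¹-norm as a seminorm. -/
def l1Seminorm (X : Type*) [TopologicalSpace X] (n : ℕ) : Seminorm ℝ (SingularChain ℝ X n) :=
  Seminorm.of l1Norm
    (fun x y => by
      classical
      rw [l1Norm_eq_sum (Finsupp.support_add (g₁ := x) (g₂ := y)),
        l1Norm_eq_sum (Finset.subset_union_left (s₁ := x.support) (s₂ := y.support)),
        l1Norm_eq_sum (Finset.subset_union_right (s₁ := x.support) (s₂ := y.support)),
        ← Finset.sum_add_distrib]
      exact Finset.sum_le_sum fun σ _ => abs_add_le _ _)
    (fun a x => by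
      rw [l1Norm_eq_sum (Finsupp.support_smul (b := a) (g := x)), l1Norm_eq_sum subset_rfl,
        Real.norm_eq_abs, Finset.mul_sum]
      simp only [Finsupp.smul_apply, smul_eq_mul, abs_mul])

end

/-! ### The marked chain complex -/

lemma boundary_single (R : Type*) [Ring R] {X : Type*} [TopologicalSpace X] {n : ℕ}
    (σ : SingularSimplex X (n + 1)) (r : R) :
    boundary R X n (Finsupp.single σ r) = r • boundaryOf R σ := by
  simp [boundary]

lemma cofaceFun_apply_self {n : ℕ} (i : Fin (n + 2)) (x : Fin (n + 1) → ℝ) :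
    cofaceFun i x i = 0 := by
  simp [cofaceFun, Fin.succAbove_ne]

lemma cofaceFun_apply_succAbove {n : ℕ} (i : Fin (n + 2)) (x : Fin (n + 1) → ℝ)
    (k : Fin (n + 1)) : cofaceFun i x (i.succAbove k) = x k := by
  simp [cofaceFun]

/-- The cosimplicial identity for iterated faces. -/
lemma coface_comp_coface {n : ℕ} (i : Fin (n + 3)) (j : Fin (n + 2)) :
    (coface (i.succAbove j)).comp (coface (j.predAbove i)) = (coface i).comp (coface j) := by
  ext x m
  change cofaceFun (i.succAbove j) (cofaceFun (j.predAbove i) x) m = cofaceFun i (cofaceFun j x) m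
  rcases Fin.eq_self_or_eq_succAbove i m with rfl | ⟨l, rfl⟩
  · rw [cofaceFun_apply_self]
    have h := cofaceFun_apply_succAbove (m.succAbove j) (cofaceFun (j.predAbove m) x)
      (j.predAbove m)
    rwa [Fin.succAbove_succAbove_predAbove, cofaceFun_apply_self] at h
  · rcases Fin.eq_self_or_eq_succAbove j l with rfl | ⟨k, rfl⟩
    · rw [cofaceFun_apply_succAbove, cofaceFun_apply_self, cofaceFun_apply_self]
    · rw [cofaceFun_apply_succAbove, cofaceFun_apply_succAbove,
        ← Fin.succAbove_succAbove_succAbove_predAbove, cofaceFun_apply_succAbove,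
        cofaceFun_apply_succAbove]

lemma boundary_boundary (R : Type*) [Ring R] {X : Type*} [TopologicalSpace X] {n : ℕ}
    (c : SingularChain R X (n + 2)) : boundary R X n (boundary R X (n + 1) c) = 0 := by
  induction c using Finsupp.induction_linear with
  | zero => simp
  | add x y hx hy => rw [map_add, map_add, hx, hy, add_zero]
  | single σ r =>
    rw [boundary_single, map_smul]
    suffices h : boundary R X n (boundaryOf R σ) = 0 by rw [h, smul_zero]
    simp only [boundaryOf, map_sum, boundary_single, Finset.smul_sum, Finsupp.smul_single,
      smul_eq_mul, ← pow_add]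
    rw [← Fintype.sum_prod_type']
    refine Finset.sum_involution (fun p _ => (p.1.succAbove p.2, p.2.predAbove p.1))
      ?_ ?_ (fun _ _ => Finset.mem_univ _) ?_
    · rintro ⟨i, j⟩ -
      simp only [Fin.neg_one_pow_succAbove_add_predAbove, ContinuousMap.comp_assoc,
        coface_comp_coface, Finsupp.single_neg, add_neg_cancel]
    · rintro ⟨i, j⟩ - - h
      exact Fin.succAbove_ne i j (congrArg Prod.fst h)
    · rintro ⟨i, j⟩ -
      simp [Fin.succAbove_succAbove_predAbove, Fin.predAbove_predAbove_succAbove]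

section

variable {X : Type*} [TopologicalSpace X] {B : Set X} {n : ℕ}

lemma Admissible.comp_coface {σ : SingularSimplex X (n + 1)} (h : Admissible B σ)
    (i : Fin (n + 2)) : Admissible B (σ.comp (coface i)) := by
  obtain ⟨𝒮, h𝒮⟩ := h
  refine ⟨(fun S => Finset.univ.filter fun k => i.succAbove k ∈ S) '' 𝒮, ?_⟩
  have hface (S : Finset (Fin (n + 2))) : coface i ⁻¹' faceSet (n + 1) S =
      faceSet n (Finset.univ.filter fun k => i.succAbove k ∈ S) := by
    ext x
    change (∀ j ∉ S, cofaceFun i x j = 0) ↔ ∀ k ∉ _, (x : Fin (n + 1) → ℝ) k = 0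
    simp [Fin.forall_iff_succAbove i, cofaceFun_apply_self, cofaceFun_apply_succAbove]
  rw [ContinuousMap.coe_comp, Set.preimage_comp, h𝒮, Set.biUnion_image]
  simp only [Set.preimage_iUnion, hface]

lemma admissible_of_range_subset {σ : SingularSimplex X n} (h : Set.range σ ⊆ B) :
    Admissible B σ := by
  refine ⟨{Finset.univ}, ?_⟩
  ext x
  simpa [faceSet] using h ⟨x, rfl⟩

variable (R : Type*) [Ring R]

lemma chainsIn_le_admissibleChains : chainsIn R X B n ≤ admissibleChains R X B n :=
  Submodule.span_mono fun _ ⟨σ, hσ, hc⟩ => ⟨σ, admissible_of_range_subset hσ, hc⟩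

lemma map_boundary_admissibleChains_le :
    (admissibleChains R X B (n + 1)).map (boundary R X n) ≤ admissibleChains R X B n := by
  rw [admissibleChains, Submodule.map_span_le]
  rintro _ ⟨σ, hσ, rfl⟩
  rw [boundary_single, one_smul]
  refine Submodule.sum_mem _ fun i _ => ?_
  rw [← mul_one ((-1 : R) ^ (i : ℕ)), ← smul_eq_mul, ← Finsupp.smul_single]
  exact Submodule.smul_mem _ _ (Submodule.subset_span ⟨_, hσ.comp_coface i, rfl⟩)

lemma map_boundary_chainsIn_le :
    (chainsIn R X B (n + 1)).map (boundary R X n) ≤ chainsIn R X B n := by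
  rw [chainsIn, Submodule.map_span_le]
  rintro _ ⟨σ, hσ, rfl⟩
  rw [boundary_single, one_smul]
  refine Submodule.sum_mem _ fun i _ => ?_
  rw [← mul_one ((-1 : R) ^ (i : ℕ)), ← smul_eq_mul, ← Finsupp.smul_single]
  exact Submodule.smul_mem _ _
    (Submodule.subset_span ⟨_, (Set.range_comp_subset_range (coface i) σ).trans hσ, rfl⟩)

lemma markedBoundaries_le_markedCycles : markedBoundaries R X B n ≤ markedCycles R X B n := by
  have hadm : markedBoundaries R X B n ≤ admissibleChains R X B n :=
    sup_le (map_boundary_admissibleChains_le R) (chainsIn_le_admissibleChains R)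
  cases n with
  | zero => exact hadm
  | succ n =>
    refine le_inf hadm (sup_le ?_ (Submodule.map_le_iff_le_comap.1 (map_boundary_chainsIn_le R)))
    rintro _ ⟨d, -, rfl⟩
    rw [Submodule.mem_comap, boundary_boundary]
    exact zero_mem _

lemma markedCycles_le_admissibleChains : markedCycles R X B n ≤ admissibleChains R X B n := by
  cases n with
  | zero => exact le_rfl
  | succ n => exact inf_le_left

lemma admissible_of_mem_support {c : SingularChain R X n} (hc : c ∈ admissibleChains R X B n)
    {σ : SingularSimplex X n} (hσ : σ ∈ c.support) : Admissible B σ := by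
  have hle : admissibleChains R X B n ≤ Finsupp.supported R R {σ | Admissible B σ} := by
    refine Submodule.span_le.2 ?_
    rintro _ ⟨τ, hτ, rfl⟩
    exact Finsupp.single_mem_supported R _ hτ
  exact hle hc hσ

end

section

variable {X : Type*} [TopologicalSpace X] {B : Set X} {i : ℕ}

lemma IsNormOneMarkedCocycle.eq_zero_of_mem_markedBoundaries
    {f : SingularChain ℝ X i →ₗ[ℝ] ℝ} (hf : IsNormOneMarkedCocycle B i f)
    {w : SingularChain ℝ X i} (hw : w ∈ markedBoundaries ℝ X B i) : f w = 0 := by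
  have hle : markedBoundaries ℝ X B i ≤ LinearMap.ker f := by
    refine sup_le ?_ hf.2.1
    rintro _ ⟨d, hd, rfl⟩
    exact hf.2.2 d hd
  exact hle hw

lemma IsNormOneMarkedCocycle.apply_le_l1Norm
    {f : SingularChain ℝ X i →ₗ[ℝ] ℝ} (hf : IsNormOneMarkedCocycle B i f)
    {z : SingularChain ℝ X i} (hz : z ∈ admissibleChains ℝ X B i) : f z ≤ l1Norm z := by
  conv_lhs => rw [← Finsupp.sum_single z]
  rw [map_finsuppSum]
  refine Finset.sum_le_sum fun σ hσ => ?_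
  calc f (Finsupp.single σ (z σ)) = z σ * f (Finsupp.single σ 1) := by
        rw [← smul_eq_mul, ← map_smul, Finsupp.smul_single, smul_eq_mul, mul_one]
    _ ≤ |z σ| * |f (Finsupp.single σ 1)| := by rw [← abs_mul]; exact le_abs_self _
    _ ≤ |z σ| := mul_le_of_le_one_right (abs_nonneg _)
        (hf.1 σ (admissible_of_mem_support ℝ hz hσ))

/-- Every chain congruent to a marked cycle modulo marked boundaries is a marked cycle, so the
seminorm of a class is a quotient seminorm on the whole chain group. -/
lemma markedClassSeminorm_eq_sInf {c : SingularChain ℝ X i} (hc : c ∈ markedCycles ℝ X B i) :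
    markedClassSeminorm B c =
      sInf {r | ∃ z, z - c ∈ markedBoundaries ℝ X B i ∧ r = l1Seminorm X i z} := by
  unfold markedClassSeminorm
  congr 1
  ext r
  constructor
  · rintro ⟨z, -, hzc, hr⟩
    exact ⟨z, hzc, hr⟩
  · rintro ⟨z, hzc, hr⟩
    refine ⟨z, ?_, hzc, hr⟩
    simpa using add_mem (markedBoundaries_le_markedCycles ℝ hzc) hc

end

/-- **Duality.** For every class `α ∈ H^M_i(X, B; ℝ)` (represented by the marked cycle `c`),
`‖α‖₁ = max { ⟨φ, α⟩ : φ ∈ H^i_M(X, B; ℝ), ‖φ‖_∞ ≤ 1 }`: the seminorm equals the maximum —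
attained — of the Kronecker pairings against marked bounded cohomology classes of dual
norm at most one. -/
theorem marked_duality {X : Type*} [TopologicalSpace X] {B : Set X}
    (hXB : IsMarkedSpace X B) (i : ℕ) (c : SingularChain ℝ X i)
    (hc : c ∈ markedCycles ℝ X B i) :
    IsGreatest { r : ℝ | ∃ f : SingularChain ℝ X i →ₗ[ℝ] ℝ,
        IsNormOneMarkedCocycle B i f ∧ r = f c }
      (markedClassSeminorm B c) := by
  constructor
  · obtain ⟨f, hf, hfW, hfc⟩ :=
      (l1Seminorm X i).exists_dual_eq_quotient (markedBoundaries ℝ X B i) c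
    refine ⟨f, ⟨fun σ _ => ?_, fun z hz => hfW z (Submodule.mem_sup_right hz),
      fun d hd => hfW _ (Submodule.mem_sup_left (Submodule.mem_map_of_mem hd))⟩, ?_⟩
    · exact (hf _).trans_eq ((l1Norm_single σ 1).trans abs_one)
    · rw [hfc, markedClassSeminorm_eq_sInf hc]
  · rintro _ ⟨f, hf, rfl⟩
    refine le_csInf ⟨_, c, hc, by simp, rfl⟩ ?_
    rintro _ ⟨z, hz, hzc, rfl⟩
    have hfz : f z = f c := by
      rw [← sub_eq_zero, ← map_sub, hf.eq_zero_of_mem_markedBoundaries hzc]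
    exact hfz ▸ hf.apply_le_l1Norm (markedCycles_le_admissibleChains ℝ hz)
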